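/- Let K be a field, G a group, A a normal subgroup of G, and B = G/A the quotient with quotient map π : G → B. Let ρ_A : A → GL_m(K) and ρ_B : B → GL_n(K) be injective group homomorphisms. Let s : B → G be a section of π with s(1) = 1, and define the factor set f : B × B → A by f(x,y) = s(x) s(y) s(xy)⁻¹ and the action A × B → A by (a, x) ↦ s(x)⁻¹ a s(x). Suppose both maps are splittable over K: for each pair of indices i,j there exist finitely many functions φ_ν : B → K, ψ_ν : B → K with (ρ_A(f(x,y)))_{ij} = Σ_ν φ_ν(x) ψ_ν(y) for all x,y ∈ B, and finitely many functions φ'_ν : A → K, ψ'_ν : B → K with (ρ_A(s(x)⁻¹ a s(x)))_{ij} = Σ_ν φ'_ν(a) ψ'_ν(x) for all a ∈ A, x ∈ B. Then G is linear over K, i.e., there exist a positive integer N and an injective group homomorphism G → GL_N(K). -/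

import Mathlib

open scoped MatrixGroups

/-- A function `F` of two variables is splittable if its sections `F · y` all lie in a common
finite-dimensional space of functions. -/
def Splittable {K X Y : Type*} [Field K] (F : X → Y → K) : Prop :=
  ∃ W : Submodule K (X → K), W.FG ∧ ∀ y, (fun x => F x y) ∈ W

namespace Splittable

variable {K X Y X' Y' : Type*} [Field K]

lemma of_left (f : X → K) : Splittable (fun x (_ : Y) => f x) :=
  ⟨K ∙ f, Submodule.fg_span_singleton f, fun _ => Submodule.mem_span_singleton_self f⟩

lemma of_right (f : Y → K) : Splittable (fun (_ : X) y => f y) :=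
  ⟨K ∙ (1 : X → K), Submodule.fg_span_singleton _, fun y =>
    Submodule.mem_span_singleton.2 ⟨f y, by ext; simp⟩⟩

lemma add {F F' : X → Y → K} (h : Splittable F) (h' : Splittable F') :
    Splittable (fun x y => F x y + F' x y) := by
  obtain ⟨W, hW, hF⟩ := h
  obtain ⟨W', hW', hF'⟩ := h'
  exact ⟨W ⊔ W', hW.sup hW', fun y => Submodule.add_mem_sup (hF y) (hF' y)⟩

lemma mul {F F' : X → Y → K} (h : Splittable F) (h' : Splittable F') :
    Splittable (fun x y => F x y * F' x y) := by
  obtain ⟨W, hW, hF⟩ := h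
  obtain ⟨W', hW', hF'⟩ := h'
  exact ⟨W * W', hW.mul hW', fun y => Submodule.mul_mem_mul (hF y) (hF' y)⟩

lemma sum {ι : Type*} (t : Finset ι) {F : ι → X → Y → K} (h : ∀ i ∈ t, Splittable (F i)) :
    Splittable (fun x y => ∑ i ∈ t, F i x y) := by
  classical
  induction t using Finset.induction_on with
  | empty => simpa using of_left (Y := Y) (0 : X → K)
  | insert i t hi ih =>
    simp only [Finset.sum_insert hi]
    exact (h i (by simp)).add (ih fun j hj => h j (by simp [hj]))

lemma comp {F : X → Y → K} (h : Splittable F) (p : X' → X) (q : Y' → Y) :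
    Splittable (fun x y => F (p x) (q y)) := by
  obtain ⟨W, hW, hF⟩ := h
  exact ⟨W.map (LinearMap.funLeft K K p), hW.map _, fun y => ⟨_, hF (q y), rfl⟩⟩

lemma sum_mul {ι : Type*} (t : Finset ι) (φ : ι → X → K) (ψ : ι → Y → K) :
    Splittable (fun x y => ∑ i ∈ t, φ i x * ψ i y) :=
  sum t fun i _ => (of_left (φ i)).mul (of_right (ψ i))

lemma matrix_mul {I J L : Type*} [Fintype J] {M : X → Y → Matrix I J K}
    {N : X → Y → Matrix J L K} (hM : ∀ i j, Splittable (fun x y => M x y i j))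
    (hN : ∀ i j, Splittable (fun x y => N x y i j)) (i : I) (j : L) :
    Splittable (fun x y => (M x y * N x y) i j) := by
  simp only [Matrix.mul_apply]
  exact sum _ fun k _ => (hM i k).mul (hN k j)

end Splittable

/-- The representation of a group on its functions by right translation. -/
def rightTranslation (K G : Type*) [Field K] [Group G] : Representation K G (G → K) where
  toFun g := LinearMap.funLeft K K (· * g)
  map_one' := by ext; simp [LinearMap.funLeft]
  map_mul' g g' := by
    refine LinearMap.ext fun h => funext fun x => ?_
    simp [LinearMap.funLeft_apply, mul_assoc]

/-- A finite family of functions with splittable right translates that distinguishes the identity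
from all other elements yields a faithful finite-dimensional representation. -/
theorem exists_injective_GL_of_splittable {K G ι : Type*} [Field K] [Group G] [Finite ι]
    (h : ι → G → K) (hsplit : ∀ i, Splittable (fun x g => h i (x * g)))
    (hone : ∀ g, (∀ i, h i g = h i 1) → g = 1) :
    ∃ (N : ℕ) (_ : 0 < N) (ρ : G →* GL (Fin N) K), Function.Injective ρ := by
  rcases subsingleton_or_nontrivial G with hG | hG
  · exact ⟨1, one_pos, 1, Function.injective_of_subsingleton _⟩
  let W : Submodule K (G → K) :=
    Submodule.span K (Set.range fun p : ι × G => rightTranslation K G p.2 (h p.1))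
  have hinv (g : G) : W ≤ W.comap (rightTranslation K G g) := by
    refine Submodule.span_le.2 ?_
    rintro _ ⟨⟨i, g'⟩, rfl⟩
    refine Submodule.subset_span ⟨(i, g * g'), ?_⟩
    simp
  have : FiniteDimensional K W := by
    choose V hV hmem using hsplit
    have : ∀ i, FiniteDimensional K (V i) := fun i => Module.Finite.iff_fg.2 (hV i)
    refine Submodule.finiteDimensional_of_le (S₂ := ⨆ i, V i) (Submodule.span_le.2 ?_)
    rintro _ ⟨⟨i, g⟩, rfl⟩
    exact (le_iSup V i) (hmem i g)
  let σ : G →* Module.End K W := (rightTranslation K G).subrepresentation W hinv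
  have hσ : Function.Injective σ := by
    refine (injective_iff_map_eq_one σ).2 fun g hg => hone g fun i => ?_
    have hi : h i ∈ W := Submodule.subset_span ⟨(i, 1), by simp⟩
    have := congrFun (congrArg Subtype.val (LinearMap.congr_fun hg ⟨h i, hi⟩)) 1
    simpa [σ, Representation.subrepresentation, rightTranslation, LinearMap.funLeft_apply] using this
  have hW : Nontrivial W := by
    by_contra hW
    rw [not_nontrivial_iff_subsingleton] at hW
    exact not_subsingleton G hσ.subsingleton
  let e := Units.mapEquiv (LinearMap.toMatrixAlgEquiv (Module.finBasis K W)).toMulEquiv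
  refine ⟨Module.finrank K W, Module.finrank_pos, e.toMonoidHom.comp σ.toHomUnits,
    e.injective.comp fun g g' hgg' => hσ ?_⟩
  exact congrArg Units.val hgg'

/-- **Lemma 2.** Let `G` be an extension of `A` by `B = G/A`, with a section `s` of the
quotient map satisfying `s 1 = 1`, factor set `f(x,y) = s(x) s(y) s(xy)⁻¹` and action
`(a, x) ↦ s(x)⁻¹ a s(x)`.  If `A` and `B` are linear over a field `K` and the maps
`(x,y) ↦ f(x,y)` and `(a,x) ↦ a^{x̂}` are splittable, then `G` is linear over `K`. -/
theorem extension_splittable_linear {K : Type*} [Field K] {G : Type*} [Group G]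
    (A : Subgroup G) [A.Normal] (m n : ℕ)
    (ρA : A →* GL (Fin m) K) (ρB : G ⧸ A →* GL (Fin n) K)
    (hρA : Function.Injective ρA) (hρB : Function.Injective ρB)
    (s : G ⧸ A → G) (hs : ∀ b : G ⧸ A, (s b : G ⧸ A) = b) (hs1 : s 1 = 1)
    (hfA : ∀ x y : G ⧸ A, s x * s y * (s (x * y))⁻¹ ∈ A)
    (haA : ∀ (a : A) (x : G ⧸ A), (s x)⁻¹ * (a : G) * s x ∈ A)
    (hsplit_f : ∀ i j : Fin m, ∃ (l : ℕ) (φ ψ : Fin l → (G ⧸ A) → K),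
      ∀ x y : G ⧸ A,
        ((ρA ⟨s x * s y * (s (x * y))⁻¹, hfA x y⟩ : GL (Fin m) K) :
          Matrix (Fin m) (Fin m) K) i j = ∑ ν : Fin l, φ ν x * ψ ν y)
    (hsplit_act : ∀ i j : Fin m, ∃ (l : ℕ) (φ : Fin l → A → K) (ψ : Fin l → (G ⧸ A) → K),
      ∀ (a : A) (x : G ⧸ A),
        ((ρA ⟨(s x)⁻¹ * (a : G) * s x, haA a x⟩ : GL (Fin m) K) :
          Matrix (Fin m) (Fin m) K) i j = ∑ ν : Fin l, φ ν a * ψ ν x) :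
    ∃ (N : ℕ) (_ : 0 < N) (ρ : G →* GL (Fin N) K), Function.Injective ρ := by
  have hmem (g : G) : g * (s g)⁻¹ ∈ A := by
    rw [← QuotientGroup.eq_one_iff, QuotientGroup.mk_mul, QuotientGroup.mk_inv, hs, mul_inv_cancel]
  let α (g : G) : A := ⟨g * (s g)⁻¹, hmem g⟩
  let c (x y : G ⧸ A) : A := ⟨s x * s y * (s (x * y))⁻¹, hfA x y⟩
  let act (a : A) (x : G ⧸ A) : A := ⟨(s x)⁻¹ * (a : G) * s x, haA a x⟩
  have hα (g g' : G) : α (g * g') =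
      α g * (c g (g : G ⧸ A)⁻¹ * act (α g') (g : G ⧸ A)⁻¹ * (c g (g : G ⧸ A)⁻¹)⁻¹) * c g g' := by
    apply Subtype.ext
    simp only [α, c, act, Subgroup.coe_mul, Subgroup.coe_inv, QuotientGroup.mk_mul,
      mul_inv_cancel, hs1]
    group
  have hc (i j) : Splittable (fun x y => (ρA (c x y) : Matrix (Fin m) (Fin m) K) i j) := by
    obtain ⟨l, φ, ψ, h⟩ := hsplit_f i j
    simpa only [c, h] using Splittable.sum_mul _ φ ψ
  have hact (i j) : Splittable (fun x a => (ρA (act a x) : Matrix (Fin m) (Fin m) K) i j) := by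
    obtain ⟨l, φ, ψ, h⟩ := hsplit_act i j
    simpa only [act, h, mul_comm] using Splittable.sum_mul _ ψ φ
  refine exists_injective_GL_of_splittable (ι := (Fin m × Fin m) ⊕ (Fin n × Fin n))
    (Sum.elim (fun p g => (ρA (α g) : Matrix (Fin m) (Fin m) K) p.1 p.2)
      (fun p g => (ρB g : Matrix (Fin n) (Fin n) K) p.1 p.2)) ?_ ?_
  · rintro (⟨i, j⟩ | ⟨i, j⟩)
    · simp only [Sum.elim_inl, hα, map_mul, Units.val_mul]
      refine Splittable.matrix_mul (Splittable.matrix_mul (fun _ _ => Splittable.of_left _)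
        (Splittable.matrix_mul (Splittable.matrix_mul (fun _ _ => Splittable.of_left _)
          fun i j => ?_) fun _ _ => Splittable.of_left _)) (fun i j => ?_) i j
      · exact (hact i j).comp (fun g : G => (g : G ⧸ A)⁻¹) α
      · exact (hc i j).comp (fun g : G => (g : G ⧸ A)) (fun g : G => (g : G ⧸ A))
    · simp only [Sum.elim_inr, QuotientGroup.mk_mul, map_mul, Units.val_mul]
      exact Splittable.matrix_mul (fun _ _ => Splittable.of_left _)
        (fun _ _ => Splittable.of_right _) i j
  · intro g hg
    have hB : (g : G ⧸ A) = ((1 : G) : G ⧸ A) :=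
      hρB (Units.ext (Matrix.ext fun i j => hg (Sum.inr (i, j))))
    have hA : α g = α 1 := hρA (Units.ext (Matrix.ext fun i j => hg (Sum.inl (i, j))))
    have := congrArg Subtype.val hA
    simpa only [α, hB, mul_left_inj] using this
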